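/- arXiv:1706.07948 — 2 statements merged into one kernel-verified Lean document; each statement's English description precedes it below -/
import Mathlib

section
/- Let A be a closed symmetric relation in 𝔥 and let {𝓗,Γ} be an AB-generalized boundary pair for A*, with component relations Γ₀, Γ₁, γ-field γ, Weyl family M, A₀ = ker Γ₀, and H(λ) as in the context. Then: (i) ker Γ := {f̂ ∈ 𝔥×𝔥 : (f̂,(0,0)) ∈ Γ} = A; (ii) T := dom Γ satisfies T = A₀ +̂ N̂_λ(T), and N̂_λ(T) is dense in N̂_λ(A*), for every λ ∈ ℂ∖ℝ; (iii) for every λ ∈ ℂ∖ℝ, γ(λ) is a bounded, densely defined, single-valued operator with dom γ(λ) = ran Γ₀ (independent of λ) and ker γ(λ) = mul Γ₀; (iv) γ(λ)* is a bounded everywhere defined operator, and Γ₁∘H(λ) = γ(conj λ)* +̂ ({0}×mul Γ₁) for every λ ∈ ℂ∖ℝ; (v) the closure clos γ(λ) is a bounded everywhere defined operator from 𝓗 to 𝔥 and satisfies clos γ(λ) = clos γ(μ) + (λ−μ)(A₀−λ)⁻¹ clos γ(μ) for all λ, μ ∈ ℂ∖ℝ; (vi) M(λ) is a single-valued densely defined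 operator with dom M(λ) = ran Γ₀ for all λ ∈ ℂ∖ℝ, M(λ) ⊆ M(conj λ)*, the operator u ↦ (2i)⁻¹(M(λ)u − M(conj λ)u) on ran Γ₀ is bounded with kernel mul Γ₀, and, for any fixed μ ∈ ℂ∖ℝ, the operator E := ½(M(μ) + M(conj μ)) on ran Γ₀ is densely defined and symmetric and M₀(λ) := M(λ) − E (on ran Γ₀) has a closure belonging to R[𝓗], so that M(λ) = E + M₀(λ). -/
noncomputable section

open Filter Topology

namespace BT

local notation "⟪" x ", " y "⟫" => @inner ℂ _ _ x y

section Ops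
variable {α β γ' : Type*}

def domR (T : Set (α × β)) : Set α := {x | ∃ y, (x, y) ∈ T}
def ranR (T : Set (α × β)) : Set β := {y | ∃ x, (x, y) ∈ T}
def kerR [Zero β] (T : Set (α × β)) : Set α := {x | (x, (0 : β)) ∈ T}
def mulR [Zero α] (T : Set (α × β)) : Set β := {y | ((0 : α), y) ∈ T}
def invR (T : Set (α × β)) : Set (β × α) := {p | (p.2, p.1) ∈ T}
def compR (T₂ : Set (β × γ')) (T₁ : Set (α × β)) : Set (α × γ') :=
  {p | ∃ y, (p.1, y) ∈ T₁ ∧ (y, p.2) ∈ T₂}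
def csum [Add α] [Add β] (T₁ T₂ : Set (α × β)) : Set (α × β) :=
  {p | ∃ q ∈ T₁, ∃ r ∈ T₂, p = (q.1 + r.1, q.2 + r.2)}

def IsLinRel {M : Type*} [AddCommGroup M] [Module ℂ M] (s : Set M) : Prop :=
  ∃ p : Submodule ℂ M, (p : Set M) = s

def IsBddRel [Norm α] [Norm β] (T : Set (α × β)) : Prop :=
  ∃ C : ℝ, ∀ p ∈ T, ‖p.2‖ ≤ C * ‖p.1‖

def BddInv [NormedAddCommGroup α] (T : Set (α × α)) : Prop :=
  (∀ v, ∃ p ∈ T, p.2 = v) ∧ (∀ p ∈ T, ∀ q ∈ T, p.2 = q.2 → p.1 = q.1) ∧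
    ∃ C : ℝ, ∀ p ∈ T, ‖p.1‖ ≤ C * ‖p.2‖
end Ops

section Shifts
variable {α : Type*} [AddCommGroup α] [Module ℂ α]

def shiftSub (T : Set (α × α)) (l : ℂ) : Set (α × α) :=
  {p | ∃ q ∈ T, p = (q.1, q.2 - l • q.1)}
def shiftAdd (T : Set (α × α)) (l : ℂ) : Set (α × α) :=
  {p | ∃ q ∈ T, p = (q.1, q.2 + l • q.1)}
def hatN (T : Set (α × α)) (l : ℂ) : Set (α × α) := {p ∈ T | p.2 = l • p.1}
def Nlam (T : Set (α × α)) (l : ℂ) : Set α := {f | (f, l • f) ∈ T}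
def Hrel (A0s : Set (α × α)) (l : ℂ) : Set (α × (α × α)) :=
  {q | q.2 ∈ A0s ∧ q.2.2 - l • q.2.1 = q.1}
end Shifts

section InnerDefs
variable {E F : Type*} [NormedAddCommGroup E] [InnerProductSpace ℂ E]
  [NormedAddCommGroup F] [InnerProductSpace ℂ F]

def adjR (S : Set (F × E)) : Set (E × F) :=
  {p | ∀ q ∈ S, ⟪p.1, q.2⟫ = ⟪p.2, q.1⟫}

def IsClosedSymRel (A : Set (E × E)) : Prop :=
  IsLinRel A ∧ IsClosed A ∧ A ⊆ adjR A

def kIP (p q : E × E) : ℂ := -Complex.I * ⟪q.1, p.2⟫ + Complex.I * ⟪q.2, p.1⟫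

def kreinOrth (S : Set (E × E)) : Set (E × E) := {v | ∀ u ∈ S, kIP u v = 0}

def GreenPair (Γ : Set ((E × E) × (F × F))) : Prop :=
  ∀ p ∈ Γ, ∀ q ∈ Γ,
    ⟪q.1.1, p.1.2⟫ - ⟪q.1.2, p.1.1⟫ = ⟪q.2.1, p.2.2⟫ - ⟪q.2.2, p.2.1⟫

def G0 (Γ : Set ((E × E) × (F × F))) : Set ((E × E) × F) := {p | ∃ h', (p.1, (p.2, h')) ∈ Γ}
def G1 (Γ : Set ((E × E) × (F × F))) : Set ((E × E) × F) := {p | ∃ h, (p.1, (h, p.2)) ∈ Γ}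
def A0 (Γ : Set ((E × E) × (F × F))) : Set (E × E) := kerR (G0 Γ)
def A1 (Γ : Set ((E × E) × (F × F))) : Set (E × E) := kerR (G1 Γ)
def weyl (Γ : Set ((E × E) × (F × F))) (l : ℂ) : Set (F × F) :=
  {p | ∃ f : E, ((f, l • f), p) ∈ Γ}
def gfield (Γ : Set ((E × E) × (F × F))) (l : ℂ) : Set (F × E) :=
  {p | ∃ h', ((p.2, l • p.2), (p.1, h')) ∈ Γ}

def kreinAdj (Γ : Set ((E × E) × (F × F))) : Set ((F × F) × (E × E)) :=
  {q | ∀ p ∈ Γ, kIP p.1 q.2 = kIP p.2 q.1}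

def IsIsomPair (A : Set (E × E)) (Γ : Set ((E × E) × (F × F))) : Prop :=
  IsLinRel Γ ∧ domR Γ ⊆ adjR A ∧ GreenPair Γ
def IsDomDense (A : Set (E × E)) (Γ : Set ((E × E) × (F × F))) : Prop :=
  closure (domR Γ) = adjR A
def IsABPair (A : Set (E × E)) (Γ : Set ((E × E) × (F × F))) : Prop :=
  IsIsomPair A Γ ∧ IsDomDense A Γ ∧ Dense (ranR (G0 Γ)) ∧ A0 Γ = adjR (A0 Γ)
def IsBPair (A : Set (E × E)) (Γ : Set ((E × E) × (F × F))) : Prop :=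
  IsABPair A Γ ∧ ranR (G0 Γ) = Set.univ
def IsUnitaryPair (A : Set (E × E)) (Γ : Set ((E × E) × (F × F))) : Prop :=
  GreenPair Γ ∧ domR Γ ⊆ adjR A ∧ IsDomDense A Γ ∧ invR Γ = kreinAdj Γ
def IsUnitaryBT (A : Set (E × E)) (Γ : Set ((E × E) × (F × F))) : Prop :=
  IsUnitaryPair A Γ ∧ mulR Γ = {0}
def IsOrdinaryBT (A : Set (E × E)) (Γ : Set ((E × E) × (F × F))) : Prop :=
  IsIsomPair A Γ ∧ mulR Γ = {0} ∧ domR Γ = adjR A ∧ ranR Γ = Set.univ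

def Erel (Γ : Set ((E × E) × (F × F))) (m : ℂ) : Set (F × F) :=
  {p | ∃ u' v', (p.1, u') ∈ weyl Γ m ∧ (p.1, v') ∈ weyl Γ ((starRingEnd ℂ) m) ∧
        p.2 = (2 : ℂ)⁻¹ • (u' + v')}

def triTransform (Γ : Set ((E × E) × (F × F))) (e : Set (F × F)) :
    Set ((E × E) × (F × F)) :=
  {q | ∃ h h' w, (q.1, (h, h')) ∈ Γ ∧ (h, w) ∈ e ∧ q.2 = (h, w + h')}

def formVal (l : ℂ) (u u' : F) : ℝ :=
  ((l - (starRingEnd ℂ) l)⁻¹ * (⟪u, u'⟫ - ⟪u', u⟫)).re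

def FormClosable (l : ℂ) (Ms : Set (F × F)) : Prop :=
  ∀ u u' : ℕ → F, (∀ n, (u n, u' n) ∈ Ms) →
    Tendsto u atTop (nhds (0 : F)) →
    Tendsto (fun nm : ℕ × ℕ => formVal l (u nm.1 - u nm.2) (u' nm.1 - u' nm.2)) atTop
      (nhds (0 : ℝ)) →
    Tendsto (fun n => formVal l (u n) (u' n)) atTop (nhds (0 : ℝ))

def formClosureDom (l : ℂ) (Ms : Set (F × F)) : Set F :=
  {v | ∃ u u' : ℕ → F, (∀ n, (u n, u' n) ∈ Ms) ∧ Tendsto u atTop (nhds v) ∧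
    Tendsto (fun nm : ℕ × ℕ => formVal l (u nm.1 - u nm.2) (u' nm.1 - u' nm.2)) atTop
      (nhds (0 : ℝ))}

end InnerDefs

section CompleteDefs
variable {F : Type*} [NormedAddCommGroup F] [InnerProductSpace ℂ F] [CompleteSpace F]

def IsNevFun (M₀ : ℂ → F →L[ℂ] F) : Prop :=
  DifferentiableOn ℂ M₀ {l : ℂ | l.im ≠ 0} ∧
  (∀ l : ℂ, l.im ≠ 0 → M₀ ((starRingEnd ℂ) l) = ContinuousLinearMap.adjoint (M₀ l)) ∧
  (∀ l : ℂ, 0 < l.im → ∀ u, 0 ≤ (⟪u, M₀ l u⟫).im)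

def ImOp (Tb : F →L[ℂ] F) : F →L[ℂ] F :=
  ((2 : ℂ) * Complex.I)⁻¹ • (Tb - ContinuousLinearMap.adjoint Tb)

end CompleteDefs

variable {E F : Type*} [NormedAddCommGroup E] [InnerProductSpace ℂ E] [CompleteSpace E]
  [NormedAddCommGroup F] [InnerProductSpace ℂ F] [CompleteSpace F]

theorem aux_bound (S : Set (E × E)) (hS : S = adjR S) (l : ℂ) (p : E × E) (hp : p ∈ S) :
    |l.im| * ‖p.1‖ ≤ ‖p.2 - l • p.1‖ := by
  have h1 : ⟪p.1, p.2⟫ = ⟪p.2, p.1⟫ := by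
    have := hp
    rw [hS] at this
    exact this p hp
  have h2 : (⟪p.1, p.2⟫).im = 0 := by
    have h3 := inner_conj_symm (𝕜 := ℂ) p.1 p.2
    rw [← h1] at h3
    exact Complex.conj_eq_iff_im.mp h3
  have h4 : (⟪p.1, p.2 - l • p.1⟫).im = - l.im * ‖p.1‖ ^ 2 := by
    rw [inner_sub_right, inner_smul_right, inner_self_eq_norm_sq_to_K, Complex.sub_im, h2]
    simp [Complex.mul_im, ← Complex.ofReal_pow]
  have h5 : |l.im| * ‖p.1‖ ^ 2 ≤ ‖p.1‖ * ‖p.2 - l • p.1‖ := by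
    calc |l.im| * ‖p.1‖ ^ 2 = |(⟪p.1, p.2 - l • p.1⟫).im| := by
          rw [h4, abs_mul, abs_neg, abs_of_nonneg (sq_nonneg ‖p.1‖)]
      _ ≤ ‖⟪p.1, p.2 - l • p.1⟫‖ := Complex.abs_im_le_norm _
      _ ≤ _ := norm_inner_le_norm _ _
  rcases (norm_nonneg p.1).eq_or_lt with h | h
  · rw [← h]; simp
  · nlinarith

theorem adjR_closed {X Y : Type*} [NormedAddCommGroup X] [InnerProductSpace ℂ X]
    [NormedAddCommGroup Y] [InnerProductSpace ℂ Y] (S : Set (Y × X)) : IsClosed (adjR S) := by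
  have : adjR S = ⋂ q ∈ S, {p : X × Y | ⟪p.1, q.2⟫ = ⟪p.2, q.1⟫} := by
    ext p; simp [adjR]
  rw [this]
  refine isClosed_biInter fun q _ => isClosed_eq ?_ ?_ <;> fun_prop

theorem resolvent_exists (P : Submodule ℂ (E × E)) (hS : (P : Set (E × E)) = adjR (P : Set (E × E)))
    (l : ℂ) (hl : l.im ≠ 0) :
    ∃ R : E →L[ℂ] E, (∀ x, (R x, x + l • R x) ∈ P) ∧ ∀ p ∈ P, p.1 = R (p.2 - l • p.1) := by
  have hpos : 0 < |l.im| := abs_pos.mpr hl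
  let φ : P →ₗ[ℂ] E := (LinearMap.snd ℂ E E - l • LinearMap.fst ℂ E E) ∘ₗ P.subtype
  have hφ : ∀ p : P, φ p = p.1.2 - l • p.1.1 := fun p => by simp [φ]
  have hb : ∀ p : P, |l.im| * ‖p.1.1‖ ≤ ‖φ p‖ := fun p => by
    rw [hφ]; exact aux_bound _ hS l p.1 p.2
  have hPc : IsClosed (P : Set (E × E)) := by rw [hS]; exact adjR_closed _
  have hanti : ∃ K : NNReal, AntilipschitzWith K φ := by
    refine ⟨⟨1 + (1 + ‖l‖) * |l.im|⁻¹, by positivity⟩, ?_⟩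
    refine AddMonoidHomClass.antilipschitz_of_bound φ fun p => ?_
    have h1 : ‖p.1.1‖ ≤ |l.im|⁻¹ * ‖φ p‖ := by
      rw [inv_mul_eq_div, le_div_iff₀ hpos, mul_comm]; exact hb p
    have h2 : ‖p.1.2‖ ≤ ‖φ p‖ + ‖l‖ * ‖p.1.1‖ := by
      have : p.1.2 = φ p + l • p.1.1 := by rw [hφ]; abel
      rw [this, ← norm_smul]; exact norm_add_le _ _
    have h3 : 0 ≤ |l.im|⁻¹ * ‖φ p‖ := by positivity
    have h4 : ‖l‖ * ‖p.1.1‖ ≤ ‖l‖ * (|l.im|⁻¹ * ‖φ p‖) := by gcongr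
    have h5 : 0 ≤ ‖l‖ * (|l.im|⁻¹ * ‖φ p‖) := by positivity
    have h6 : ‖p‖ = max ‖p.1.1‖ ‖p.1.2‖ := rfl
    rw [h6]
    change _ ≤ (1 + (1 + ‖l‖) * |l.im|⁻¹) * ‖φ p‖
    refine max_le ?_ ?_ <;> nlinarith [norm_nonneg (φ p)]
  obtain ⟨K, hK⟩ := hanti
  have hcont : UniformContinuous φ := by
    have : Continuous φ := by
      have : (φ : P → E) = fun p => p.1.2 - l • p.1.1 := funext hφ
      rw [this]; fun_prop
    exact uniformContinuous_addMonoidHom_of_continuous this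
  have hcl : IsClosed (Set.range φ) := by
    have : CompleteSpace P := hPc.completeSpace_coe
    exact hK.isClosed_range hcont
  have hsurj : Function.Surjective φ := by
    have hrc : IsClosed (LinearMap.range φ : Set E) := by rw [LinearMap.coe_range]; exact hcl
    have : CompleteSpace (LinearMap.range φ) := hrc.completeSpace_coe
    rw [← LinearMap.range_eq_top, ← Submodule.orthogonal_eq_bot_iff, Submodule.eq_bot_iff]
    intro k hk
    rw [Submodule.mem_orthogonal'] at hk
    have hmem : (k, (starRingEnd ℂ) l • k) ∈ (P : Set (E × E)) := by
      rw [hS]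
      intro q hq
      have := hk (φ ⟨q, hq⟩) (LinearMap.mem_range_self _ _)
      rw [hφ, inner_sub_right, inner_smul_right, sub_eq_zero] at this
      rw [inner_smul_left, Complex.conj_conj]
      exact this
    have := aux_bound _ hS ((starRingEnd ℂ) l) _ hmem
    simp only [sub_self, norm_zero, Complex.conj_im, abs_neg] at this
    have h0 : ‖k‖ ≤ 0 := by
      by_contra h
      push Not at h
      nlinarith [mul_pos hpos h]
    exact norm_le_zero_iff.mp h0
  let e := LinearEquiv.ofBijective φ ⟨hK.injective, hsurj⟩
  have he : ∀ x, φ (e.symm x) = x := fun x => e.apply_symm_apply x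
  let R₀ : E →ₗ[ℂ] E := LinearMap.fst ℂ E E ∘ₗ P.subtype ∘ₗ e.symm.toLinearMap
  have hR₀ : ∀ x, R₀ x = (e.symm x).1.1 := fun x => rfl
  let R : E →L[ℂ] E := R₀.mkContinuous |l.im|⁻¹ (fun x => by
      rw [hR₀, inv_mul_eq_div, le_div_iff₀ hpos, mul_comm]
      have := hb (e.symm x)
      rwa [he] at this)
  have hR : ∀ x, R x = (e.symm x).1.1 := fun x => rfl
  refine ⟨R, fun x => ?_, fun p hp => ?_⟩
  · have h1 := he x
    rw [hφ] at h1
    have h2 : (R x, x + l • R x) = (e.symm x).1 := by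
      rw [hR]
      refine Prod.ext rfl ?_
      change x + l • (e.symm x).1.1 = (e.symm x).1.2
      nth_rewrite 1 [← h1]
      abel
    rw [h2]; exact (e.symm x).2
  · rw [hR, ← hφ ⟨p, hp⟩]
    have : e.symm (φ ⟨p, hp⟩) = ⟨p, hp⟩ := e.symm_apply_apply _
    rw [this]

theorem double_adj (A : Set (E × E)) (hA : IsLinRel A) (hc : IsClosed A) :
    adjR (adjR A) ⊆ A := by
  obtain ⟨P, rfl⟩ := hA
  intro v hv
  by_contra hvn
  obtain ⟨f, u, hf1, hf2⟩ := RCLike.geometric_hahn_banach_closed_point (𝕜 := ℂ)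
    (P.restrictScalars ℝ).convex hc hvn
  have hu : 0 < u := by simpa using hf1 0 P.zero_mem
  have hz : ∀ a ∈ P, f a = 0 := by
    intro a ha
    by_contra h
    have := hf1 (((u : ℂ) / f a) • a) (P.smul_mem _ ha)
    rw [map_smul, smul_eq_mul, div_mul_cancel₀ _ h] at this
    simp at this
  let a := (InnerProductSpace.toDual ℂ E).symm (f.comp (ContinuousLinearMap.inl ℂ E E))
  let b := (InnerProductSpace.toDual ℂ E).symm (f.comp (ContinuousLinearMap.inr ℂ E E))
  have hfab : ∀ p : E × E, f p = ⟪a, p.1⟫ + ⟪b, p.2⟫ := by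
    intro p
    simp only [a, b, InnerProductSpace.toDual_symm_apply, ContinuousLinearMap.comp_apply,
      ContinuousLinearMap.inl_apply, ContinuousLinearMap.inr_apply]
    rw [← map_add]; simp
  have hmem : (b, -a) ∈ adjR (P : Set (E × E)) := by
    intro q hq
    have := hz q hq
    rw [hfab] at this
    rw [inner_neg_left]
    linear_combination this
  have h1 := hv _ hmem
  simp only [inner_neg_right] at h1
  have h2 : f v = 0 := by
    rw [hfab, ← inner_conj_symm, ← inner_conj_symm b, ← map_add]
    rw [← h1]; simp
  rw [h2] at hf2
  simp at hf2
  linarith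

theorem zero_of_dense {X : Type*} [NormedAddCommGroup X] [InnerProductSpace ℂ X]
    {S : Set X} (hS : Dense S) (x : X) (h : ∀ y ∈ S, ⟪x, y⟫ = 0) : x = 0 := by
  have : (fun y : X => ⟪x, y⟫) = fun _ => 0 :=
    Continuous.ext_on hS (by fun_prop) (by fun_prop) h
  exact inner_self_eq_zero.mp (congrFun this x)

theorem mem_A0 (Γ : Set ((E × E) × (F × F))) (p : E × E) :
    p ∈ A0 Γ ↔ ∃ k, (p, ((0 : F), k)) ∈ Γ := Iff.rfl

def A0sub (Γ : Submodule ℂ ((E × E) × (F × F))) : Submodule ℂ (E × E) where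
  carrier := A0 (Γ : Set ((E × E) × (F × F)))
  zero_mem' := ⟨0, Γ.zero_mem⟩
  add_mem' := by
    rintro a b ⟨k, hk⟩ ⟨k', hk'⟩
    refine ⟨k + k', ?_⟩
    simpa using Γ.add_mem hk hk'
  smul_mem' := by
    rintro c a ⟨k, hk⟩
    refine ⟨c • k, ?_⟩
    simpa using Γ.smul_mem c hk

theorem mul_is_zero (Γ : Submodule ℂ ((E × E) × (F × F)))
    (hG : GreenPair (Γ : Set ((E × E) × (F × F)))) (hd : Dense (ranR (G0 (Γ : Set ((E × E) × (F × F))))))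
    (k : F) (hk : ((0, 0), (0, k)) ∈ Γ) : k = 0 := by
  refine zero_of_dense hd k ?_
  rintro h ⟨p, h', hp⟩
  have := hG _ hp _ hk
  simpa using this

theorem ab_K (Γ : Submodule ℂ ((E × E) × (F × F)))
    (hG : GreenPair (Γ : Set ((E × E) × (F × F)))) (hd : Dense (ranR (G0 (Γ : Set ((E × E) × (F × F))))))
    (hsa : A0 (Γ : Set ((E × E) × (F × F))) = adjR (A0 (Γ : Set ((E × E) × (F × F)))))
    (l : ℂ) (hl : l.im ≠ 0) :
    ∃ (R : E →L[ℂ] E) (K : E →L[ℂ] F), (∀ x, ((R x, x + l • R x), (0, K x)) ∈ Γ) ∧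
      ∀ p k, (p, (0, k)) ∈ Γ → p.1 = R (p.2 - l • p.1) := by
  obtain ⟨R, hR1, hR2⟩ := resolvent_exists (A0sub Γ) hsa l hl
  have hmem : ∀ x, ∃ k, ((R x, x + l • R x), (0, k)) ∈ Γ := hR1
  choose K hK using hmem
  have huniq : ∀ p k k', (p, ((0 : F), k)) ∈ Γ → (p, ((0 : F), k')) ∈ Γ → k = k' := by
    intro p k k' h h'
    have := Γ.sub_mem h h'
    rw [← sub_eq_zero]
    apply mul_is_zero Γ hG hd
    convert this using 2 <;> simp
  let K₀ : E →ₗ[ℂ] F :=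
    { toFun := K
      map_add' := fun x y => by
        refine huniq _ _ _ (hK _) ?_
        have := Γ.add_mem (hK x) (hK y)
        convert this using 2 <;> simp
        abel
      map_smul' := fun c x => by
        refine huniq _ _ _ (hK _) ?_
        have := Γ.smul_mem c (hK x)
        convert this using 2 <;> simp [smul_comm c l] }
  have hgr : ∀ x, ∀ f h h', ((f, (starRingEnd ℂ) l • f), (h, h')) ∈ Γ → ⟪x, f⟫ = ⟪K x, h⟫ := by
    intro x f h h' hf
    have := hG _ hf _ (hK x)
    simp only [inner_smul_right, inner_add_left, inner_smul_left, inner_zero_left] at this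
    linear_combination -this
  have hcl : IsClosed (K₀.graph : Set (E × F)) := by
    have : (K₀.graph : Set (E × F)) = adjR (gfield (Γ : Set ((E × E) × (F × F))) ((starRingEnd ℂ) l)) := by
      ext ⟨x, k⟩
      rw [SetLike.mem_coe, LinearMap.mem_graph_iff]
      constructor
      · rintro h
        change k = K x at h
        subst h
        rintro ⟨h, f⟩ ⟨h', hf⟩
        exact hgr x f h h' hf
      · intro hx
        change k = K x
        rw [← sub_eq_zero]
        refine zero_of_dense hd _ ?_
        rintro h ⟨p, h', hp⟩
        obtain ⟨R', hR1', -⟩ := resolvent_exists (A0sub Γ) hsa ((starRingEnd ℂ) l) (by simpa using hl)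
        set l' := (starRingEnd ℂ) l
        obtain ⟨k', hk'⟩ := hR1' (p.2 - l' • p.1)
        have h1 := Γ.sub_mem hp hk'
        have h2 : ((p.1 - R' (p.2 - l' • p.1), l' • (p.1 - R' (p.2 - l' • p.1))), (h, h' - k')) ∈ Γ := by
          convert h1 using 2
          · refine Prod.ext (by simp) ?_
            simp only [Prod.fst_sub, Prod.snd_sub, smul_sub]; abel
          · simp
        have h3 := hx (h, _) ⟨_, h2⟩
        have h4 := hgr x _ _ _ h2
        rw [inner_sub_left, ← h3, h4, sub_self]
    rw [this]; exact adjR_closed _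
  refine ⟨R, ⟨K₀, K₀.continuous_of_isClosed_graph hcl⟩, hK, fun p k hp => hR2 p ⟨k, hp⟩⟩

theorem graph_closure {X Y : Type*} [NormedAddCommGroup X] [NormedSpace ℂ X]
    [NormedAddCommGroup Y] [NormedSpace ℂ Y] {D : Set X} (hD : Dense D) (L : X →L[ℂ] Y) :
    closure {p : X × Y | p.1 ∈ D ∧ p.2 = L p.1} = {p : X × Y | p.2 = L p.1} := by
  apply subset_antisymm
  · refine closure_minimal (fun p hp => hp.2) (isClosed_eq ?_ ?_) <;> fun_prop
  · rintro ⟨x, y⟩ hxy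
    change y = L x at hxy
    subst hxy
    have h1 : (fun z : X => (z, L z)) '' closure D ⊆ closure ((fun z : X => (z, L z)) '' D) :=
      image_closure_subset_closure_image (by fun_prop)
    have h2 := h1 ⟨x, hD x, rfl⟩
    refine closure_mono ?_ h2
    rintro _ ⟨z, hz, rfl⟩
    exact ⟨hz, rfl⟩

theorem clm_ext_dense {X Y : Type*} [NormedAddCommGroup X] [NormedSpace ℂ X]
    [NormedAddCommGroup Y] [NormedSpace ℂ Y] {D : Set X} (hD : Dense D) (L L' : X →L[ℂ] Y)
    (h : ∀ x ∈ D, L x = L' x) : L = L' :=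
  ContinuousLinearMap.ext fun x => congrFun (Continuous.ext_on hD L.continuous L'.continuous h) x

theorem resolvent_diff (R : ℂ → E →L[ℂ] E)
    (hR : ∀ l m : ℂ, l.im ≠ 0 → m.im ≠ 0 → ∀ x, R l x = R m (x + (l - m) • R l x))
    (m : ℂ) (hm : m.im ≠ 0) : DifferentiableAt ℂ R m := by
  have hopen : IsOpen {l : ℂ | l.im ≠ 0} := isOpen_ne_fun Complex.continuous_im continuous_const
  let φ : ℂ → (E →L[ℂ] E) := fun l => 1 - (l - m) • R m
  have hφ : Differentiable ℂ φ := by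
    intro l; simp only [φ]; fun_prop
  have hφm : φ m = 1 := by simp [φ]
  have hu : ∀ᶠ l in 𝓝 m, IsUnit (φ l) := by
    have : {x : E →L[ℂ] E | IsUnit x} ∈ 𝓝 (φ m) :=
      Units.isOpen.mem_nhds (by rw [hφm]; exact isUnit_one)
    exact hφ.continuous.continuousAt this
  have heq : R =ᶠ[𝓝 m] fun l => Ring.inverse (φ l) * R m := by
    filter_upwards [hu, hopen.mem_nhds hm] with l h1 h2
    have h3 : φ l * R l = R m := by
      ext x
      have := hR l m h2 hm x
      simp only [φ, ContinuousLinearMap.mul_apply, ContinuousLinearMap.sub_apply,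
        ContinuousLinearMap.one_apply, ContinuousLinearMap.smul_apply]
      rw [map_add, map_smul] at this
      nth_rewrite 1 [this]
      abel
    rw [← h3, ← mul_assoc, Ring.inverse_mul_cancel _ h1, one_mul]
  refine DifferentiableAt.congr_of_eventuallyEq ?_ heq
  refine DifferentiableAt.mul ?_ (differentiableAt_const _)
  refine DifferentiableAt.comp m (differentiableAt_inverse ?_) (hφ m)
  rw [hφm]; exact isUnit_one

/-- All operator-level data attached to an AB-generalized boundary pair. -/
theorem ab_data (Γ : Submodule ℂ ((E × E) × (F × F)))
    (hG : GreenPair (Γ : Set ((E × E) × (F × F)))) (hd : Dense (ranR (G0 (Γ : Set ((E × E) × (F × F))))))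
    (hsa : A0 (Γ : Set ((E × E) × (F × F))) = adjR (A0 (Γ : Set ((E × E) × (F × F))))) :
    ∃ (R : ℂ → E →L[ℂ] E) (K : ℂ → E →L[ℂ] F) (G : ℂ → F →L[ℂ] E),
      (∀ l : ℂ, l.im ≠ 0 → ∀ x, ((R l x, x + l • R l x), (0, K l x)) ∈ Γ) ∧
      (∀ l : ℂ, l.im ≠ 0 → ∀ p k, (p, (0, k)) ∈ Γ →
        p.1 = R l (p.2 - l • p.1) ∧ k = K l (p.2 - l • p.1)) ∧
      (∀ l : ℂ, G l = ContinuousLinearMap.adjoint (K ((starRingEnd ℂ) l))) ∧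
      (∀ l : ℂ, l.im ≠ 0 → ∀ f h h', ((f, l • f), (h, h')) ∈ Γ → f = G l h) ∧
      (∀ l : ℂ, l.im ≠ 0 → ∀ h ∈ ranR (G0 (Γ : Set ((E × E) × (F × F)))),
        ∃ h', ((G l h, l • G l h), (h, h')) ∈ Γ) := by
  have h := ab_K Γ hG hd hsa
  choose! R K hK hR using h
  have hKu : ∀ l : ℂ, l.im ≠ 0 → ∀ p k, (p, (0, k)) ∈ Γ →
        p.1 = R l (p.2 - l • p.1) ∧ k = K l (p.2 - l • p.1) := by
    intro l hl p k hp
    have h1 := hR l hl p k hp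
    refine ⟨h1, ?_⟩
    have h2 := Γ.sub_mem hp (hK l hl (p.2 - l • p.1))
    rw [← h1] at h2
    rw [← sub_eq_zero]
    apply mul_is_zero Γ hG hd
    convert h2 using 2
    · refine Prod.ext (by simp) (by simp)
    · simp
  have hGr : ∀ l : ℂ, l.im ≠ 0 → ∀ f h h', ((f, l • f), (h, h')) ∈ Γ →
      f = ContinuousLinearMap.adjoint (K ((starRingEnd ℂ) l)) h := by
    intro l hl f h h' hf
    refine ext_inner_left ℂ fun x => ?_
    rw [ContinuousLinearMap.adjoint_inner_right]
    have := hG _ hf _ (hK ((starRingEnd ℂ) l) (by simpa using hl) x)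
    simp only [inner_smul_right, inner_add_left, inner_smul_left, inner_zero_left,
      Complex.conj_conj] at this
    linear_combination -this
  refine ⟨R, K, fun l => ContinuousLinearMap.adjoint (K ((starRingEnd ℂ) l)), hK, hKu,
    fun _ => rfl, hGr, ?_⟩
  rintro l hl h ⟨p, h', hp⟩
  have h1 := Γ.sub_mem hp (hK l hl (p.2 - l • p.1))
  set g := R l (p.2 - l • p.1)
  have h2 : ((p.1 - g, l • (p.1 - g)), (h, h' - K l (p.2 - l • p.1))) ∈ Γ := by
    convert h1 using 2
    · refine Prod.ext (by simp) ?_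
      simp only [Prod.fst_sub, Prod.snd_sub, smul_sub]; abel
    · simp
  rw [hGr l hl _ _ _ h2] at h2
  exact ⟨_, h2⟩

/-- central properties of an AB-generalized boundary pair. -/
theorem statement4 (A : Set (E × E)) (Γ : Set ((E × E) × (F × F)))
    (hA : IsClosedSymRel A) (hΓ : IsABPair A Γ) :
    -- (i) ker Γ = A
    ({p : E × E | (p, ((0 : F), (0 : F))) ∈ Γ} = A) ∧
    -- (ii)
    (∀ l : ℂ, l.im ≠ 0 →
       domR Γ = csum (A0 Γ) (hatN (domR Γ) l) ∧
       closure (hatN (domR Γ) l) = hatN (adjR A) l) ∧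
    -- (iii)
    (∀ l : ℂ, l.im ≠ 0 →
       mulR (gfield Γ l) = {(0 : E)} ∧ IsBddRel (gfield Γ l) ∧
       Dense (domR (gfield Γ l)) ∧ domR (gfield Γ l) = ranR (G0 Γ) ∧
       kerR (gfield Γ l) = mulR (G0 Γ)) ∧
    -- (iv)
    (∀ l : ℂ, l.im ≠ 0 →
       domR (adjR (gfield Γ l)) = Set.univ ∧ mulR (adjR (gfield Γ l)) = {(0 : F)} ∧
       IsBddRel (adjR (gfield Γ l)) ∧
       compR (G1 Γ) (Hrel (A0 Γ) l) =
         csum (adjR (gfield Γ ((starRingEnd ℂ) l)))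
           {p : E × F | p.1 = 0 ∧ p.2 ∈ mulR (G1 Γ)}) ∧
    -- (v)
    (∀ l : ℂ, l.im ≠ 0 →
       domR (closure (gfield Γ l)) = Set.univ ∧ mulR (closure (gfield Γ l)) = {(0 : E)} ∧
       IsBddRel (closure (gfield Γ l)) ∧
       (∀ m : ℂ, m.im ≠ 0 → ∀ (h : F) (fm : E), (h, fm) ∈ closure (gfield Γ m) →
          ∃ g : E, (fm, g) ∈ invR (shiftSub (A0 Γ) l) ∧
            (h, fm + (l - m) • g) ∈ closure (gfield Γ l))) ∧
    -- (vi)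
    ((∀ l : ℂ, l.im ≠ 0 →
       mulR (weyl Γ l) = {(0 : F)} ∧ Dense (domR (weyl Γ l)) ∧
       domR (weyl Γ l) = ranR (G0 Γ) ∧
       weyl Γ l ⊆ adjR (weyl Γ ((starRingEnd ℂ) l)) ∧
       (∃ C : ℝ, ∀ u u' v' : F, (u, u') ∈ weyl Γ l → (u, v') ∈ weyl Γ ((starRingEnd ℂ) l) →
          ‖((2 : ℂ) * Complex.I)⁻¹ • (u' - v')‖ ≤ C * ‖u‖) ∧
       {u : F | ∃ u', (u, u') ∈ weyl Γ l ∧ (u, u') ∈ weyl Γ ((starRingEnd ℂ) l)}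
         = mulR (G0 Γ)) ∧
     (∀ m : ℂ, m.im ≠ 0 →
       Dense (domR (Erel Γ m)) ∧ Erel Γ m ⊆ adjR (Erel Γ m) ∧
       ∃ N : ℂ → F →L[ℂ] F, IsNevFun N ∧
         ∀ l : ℂ, l.im ≠ 0 →
           closure {p : F × F | ∃ u' w, (p.1, u') ∈ weyl Γ l ∧ (p.1, w) ∈ Erel Γ m ∧
               p.2 = u' - w}
             = {p : F × F | p.2 = N l p.1})) := by
  obtain ⟨hAl, hAc, hAs⟩ := hA
  obtain ⟨⟨hlin, hdom, hG⟩, hdd, hd, hsa⟩ := hΓ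
  obtain ⟨P, rfl⟩ := hlin
  obtain ⟨R, K, G, hK, hKu, hGK, hGr, hGd⟩ := ab_data P hG hd hsa
  set Γ : Set ((E × E) × (F × F)) := (P : Set ((E × E) × (F × F))) with hΓdef
  have hc : ∀ l : ℂ, l.im ≠ 0 → ((starRingEnd ℂ) l).im ≠ 0 := fun l hl => by simpa using hl
  set D : Set F := ranR (G0 Γ) with hD
  have hA0 : ∀ l : ℂ, l.im ≠ 0 → ∀ x, (R l x, x + l • R l x) ∈ A0 Γ := fun l hl x =>
    ⟨_, hK l hl x⟩
  -- the gamma field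
  have hgf : ∀ l : ℂ, l.im ≠ 0 → gfield Γ l = {p : F × E | p.1 ∈ D ∧ p.2 = G l p.1} := by
    intro l hl
    ext ⟨h, f⟩
    constructor
    · rintro ⟨h', hf⟩
      exact ⟨⟨_, h', hf⟩, hGr l hl f h h' hf⟩
    · rintro ⟨h1, h2⟩
      change f = G l h at h2
      subst h2
      exact hGd l hl h h1
  have hgc : ∀ l : ℂ, l.im ≠ 0 → closure (gfield Γ l) = {p : F × E | p.2 = G l p.1} := by
    intro l hl
    rw [hgf l hl]; exact graph_closure hd (G l)
  have hga : ∀ l : ℂ, l.im ≠ 0 →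
      adjR (gfield Γ l) = {p : E × F | p.2 = K ((starRingEnd ℂ) l) p.1} := by
    intro l hl
    rw [hgf l hl]
    ext ⟨x, k⟩
    constructor
    · intro hx
      change k = K ((starRingEnd ℂ) l) x
      rw [← sub_eq_zero]
      refine zero_of_dense hd _ fun h hh => ?_
      have h1 : ⟪x, G l h⟫ = ⟪k, h⟫ := hx (h, G l h) ⟨hh, rfl⟩
      rw [hGK, ContinuousLinearMap.adjoint_inner_right] at h1
      rw [inner_sub_left, h1, sub_self]
    · intro hx
      change k = K ((starRingEnd ℂ) l) x at hx
      subst hx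
      rintro ⟨h, f⟩ ⟨hh, hf⟩
      change f = G l h at hf
      subst hf
      change ⟪x, G l h⟫ = ⟪K ((starRingEnd ℂ) l) x, h⟫
      rw [hGK, ContinuousLinearMap.adjoint_inner_right]
  have hGid : ∀ l m : ℂ, l.im ≠ 0 → m.im ≠ 0 → ∀ h, G l h = G m h + (l - m) • R l (G m h) := by
    intro l m hl hm
    have : G l = G m + (l - m) • (R l ∘L G m) := by
      refine clm_ext_dense hd _ _ fun h hh => ?_
      obtain ⟨h', h1⟩ := hGd m hm h hh
      have h2 := P.add_mem h1 (P.smul_mem (l - m) (hK l hl (G m h)))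
      refine (hGr l hl (G m h + (l - m) • R l (G m h)) h (h' + (l - m) • K l (G m h)) ?_).symm
      convert h2 using 2
      · refine Prod.ext (by simp) ?_
        simp only [Prod.smul_mk, Prod.mk_add_mk]
        module
      · simp
    intro h
    rw [this]; rfl
  have hKid : ∀ l m : ℂ, l.im ≠ 0 → m.im ≠ 0 → ∀ x,
      R l x = R m (x + (l - m) • R l x) ∧ K l x = K m (x + (l - m) • R l x) := by
    intro l m hl hm x
    have h1 := hKu m hm _ _ (hK l hl x)
    have h2 : (x + l • R l x) - m • R l x = x + (l - m) • R l x := by module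
    simp only [h2] at h1
    exact h1
  -- the Weyl family
  have hwD : ∀ l : ℂ, l.im ≠ 0 → ∀ u ∈ D, ∃ u', (u, u') ∈ weyl Γ l := by
    intro l hl u hu
    obtain ⟨h', h1⟩ := hGd l hl u hu
    exact ⟨h', _, h1⟩
  have hwD' : ∀ l u u', (u, u') ∈ weyl Γ l → u ∈ D := by
    rintro l u u' ⟨f, hf⟩
    exact ⟨_, _, hf⟩
  have hwd : ∀ l m : ℂ, l.im ≠ 0 → m.im ≠ 0 → ∀ u u' v', (u, u') ∈ weyl Γ l →
      (u, v') ∈ weyl Γ m → u' - v' = (l - m) • K l (G m u) := by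
    rintro l m hl hm u u' v' ⟨f, hf⟩ ⟨g, hg⟩
    have hg' := hGr m hm _ _ _ hg
    have h1 : ((f - g, l • f - m • g), ((0 : F), u' - v')) ∈ P := by
      have := P.sub_mem hf hg
      convert this using 2 <;> simp
    have h2 := (hKu l hl _ _ h1).2
    rw [h2, ← map_smul, ← hg']
    congr 1
    module
  have hwu : ∀ l : ℂ, l.im ≠ 0 → ∀ u u' v', (u, u') ∈ weyl Γ l →
      (u, v') ∈ weyl Γ l → u' = v' := by
    intro l hl u u' v' h1 h2
    have := hwd l l hl hl u u' v' h1 h2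
    rw [sub_self, zero_smul, sub_eq_zero] at this
    exact this
  have hws : ∀ l u u' v v', (u, u') ∈ weyl Γ l → (v, v') ∈ weyl Γ ((starRingEnd ℂ) l) →
      ⟪u, v'⟫ = ⟪u', v⟫ := by
    rintro l u u' v v' ⟨f, hf⟩ ⟨g, hg⟩
    have := hG _ hg _ hf
    simp only [inner_smul_left, inner_smul_right, sub_self] at this
    exact sub_eq_zero.mp this.symm
  have hw0 : ∀ u u', ((0, 0), (u, u')) ∈ P → ∀ l, (u, u') ∈ weyl Γ l := by
    intro u u' h l
    refine ⟨0, ?_⟩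
    rw [smul_zero]; exact h
  have hwdom : ∀ l : ℂ, l.im ≠ 0 → domR (weyl Γ l) = D := by
    intro l hl
    ext u
    exact ⟨fun ⟨u', h⟩ => hwD' _ _ _ h, fun h => hwD l hl u h⟩
  have hgker : ∀ l : ℂ, kerR (gfield Γ l) = mulR (G0 Γ) := by
    intro l
    ext h
    constructor
    · rintro ⟨h', hh⟩
      refine ⟨h', ?_⟩
      change ((0, l • 0), (h, h')) ∈ Γ at hh
      rw [smul_zero] at hh
      exact hh
    · rintro ⟨h', hh⟩
      refine ⟨h', ?_⟩
      change ((0, l • 0), (h, h')) ∈ Γ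
      rw [smul_zero]
      exact hh
  refine ⟨?_, ?_, ?_, ?_, ?_, ?_, ?_⟩
  · -- (i)
    have hGA : ∀ p ∈ adjR (domR Γ), p ∈ A := by
      intro p hp
      refine double_adj A hAl hAc fun q hq => ?_
      rw [← hdd] at hq
      have hcl : IsClosed {q : E × E | ⟪p.1, q.2⟫ = ⟪p.2, q.1⟫} := by
        refine isClosed_eq ?_ ?_ <;> fun_prop
      exact closure_minimal (fun q hq => hp q hq) hcl hq
    apply subset_antisymm
    · intro p hp
      refine hGA p ?_
      rintro q ⟨k, hq⟩
      have := hG _ hq _ hp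
      simp only [inner_zero_left, sub_self] at this
      exact sub_eq_zero.mp this
    · intro p hp
      have hp0 : p ∈ A0 Γ := by
        rw [hsa]
        rintro q ⟨k, hq⟩
        have h1 := hdom ⟨_, hq⟩ p hp
        rw [← inner_conj_symm, ← h1, inner_conj_symm] 
      obtain ⟨k, hk⟩ := hp0
      have hk0 : k = 0 := by
        refine zero_of_dense hd k ?_
        rintro h ⟨q, h', hq⟩
        have h1 := hG _ hq _ hk
        have h2 := hdom ⟨_, hq⟩ p hp
        have h3 : ⟪p.1, q.2⟫ = ⟪p.2, q.1⟫ := by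
          rw [← inner_conj_symm, ← h2, inner_conj_symm]
        simp only [inner_zero_left, h3, sub_self] at h1
        linear_combination h1
      subst hk0
      exact hk
  · -- (ii)
    intro l hl
    have hdec : ∀ p ∈ domR Γ, (p.1 - R l (p.2 - l • p.1), l • (p.1 - R l (p.2 - l • p.1))) ∈ domR Γ := by
      rintro p ⟨k, hp⟩
      have h1 := P.sub_mem hp (hK l hl (p.2 - l • p.1))
      refine ⟨k - (0, K l (p.2 - l • p.1)), ?_⟩
      have h2 : (p.1 - R l (p.2 - l • p.1), l • (p.1 - R l (p.2 - l • p.1))) =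
          p - (R l (p.2 - l • p.1), (p.2 - l • p.1) + l • R l (p.2 - l • p.1)) := by
        refine Prod.ext rfl ?_
        simp only [Prod.snd_sub, smul_sub]; abel
      rw [h2]
      exact h1
    refine ⟨?_, ?_⟩
    · ext p
      constructor
      · intro hp
        refine ⟨_, hA0 l hl (p.2 - l • p.1), _, ⟨hdec p hp, rfl⟩, ?_⟩
        refine Prod.ext (by simp) ?_
        simp only [smul_sub]; abel
      · rintro ⟨q, ⟨k, hq⟩, r, ⟨⟨k', hr⟩, -⟩, rfl⟩
        exact ⟨_, P.add_mem hq hr⟩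
    · apply subset_antisymm
      · refine closure_minimal (fun p hp => ⟨hdom hp.1, hp.2⟩) ?_
        refine (adjR_closed A).inter (isClosed_eq ?_ ?_) <;> fun_prop
      · rintro p ⟨hp1, hp2⟩
        rw [← hdd] at hp1
        let φ : E × E → E × E := fun p =>
          (p.1 - R l (p.2 - l • p.1), l • (p.1 - R l (p.2 - l • p.1)))
        have hφ : Continuous φ := by simp only [φ]; fun_prop
        have hφp : φ p = p := by
          refine Prod.ext ?_ ?_ <;> simp [φ, hp2]
        have h1 : φ '' closure (domR Γ) ⊆ closure (φ '' domR Γ) :=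
          image_closure_subset_closure_image hφ
        have h2 := h1 ⟨p, hp1, hφp⟩
        refine closure_mono ?_ h2
        rintro _ ⟨q, hq, rfl⟩
        exact ⟨hdec q hq, rfl⟩
  · -- (iii)
    intro l hl
    have hdg : domR (gfield Γ l) = D := by
      rw [hgf l hl]
      ext u
      exact ⟨fun ⟨f, h, _⟩ => h, fun h => ⟨G l u, h, rfl⟩⟩
    refine ⟨?_, ?_, ?_, hdg, hgker l⟩
    · rw [hgf l hl]
      ext f
      constructor
      · rintro ⟨-, h⟩
        simpa using h
      · rintro rfl
        exact ⟨⟨0, 0, P.zero_mem⟩, by simp⟩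
    · rw [hgf l hl]
      refine ⟨‖G l‖, ?_⟩
      rintro ⟨h, f⟩ ⟨-, hf⟩
      change f = G l h at hf
      subst hf
      exact (G l).le_opNorm h
    · rw [hdg]; exact hd
  · -- (iv)
    intro l hl
    refine ⟨?_, ?_, ?_, ?_⟩
    · rw [hga l hl]
      exact Set.eq_univ_of_forall fun x => ⟨K ((starRingEnd ℂ) l) x, rfl⟩
    · rw [hga l hl]
      ext k
      simp [mulR]
    · rw [hga l hl]
      refine ⟨‖K ((starRingEnd ℂ) l)‖, ?_⟩
      rintro ⟨x, k⟩ hk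
      change k = K ((starRingEnd ℂ) l) x at hk
      subst hk
      exact ContinuousLinearMap.le_opNorm _ x
    · rw [hga _ (hc l hl), Complex.conj_conj]
      ext ⟨x, k⟩
      constructor
      · rintro ⟨y, ⟨⟨k', hy0⟩, hyx⟩, ⟨h, hy⟩⟩
        have h1 := (hKu l hl _ _ hy0).2
        change y.2 - l • y.1 = x at hyx
        change (y, (0, k')) ∈ P at hy0
        change (y, (h, k)) ∈ P at hy
        rw [hyx] at h1
        refine ⟨(x, k'), h1, (0, k - k'), ⟨rfl, h, ?_⟩, ?_⟩
        · have := P.sub_mem hy hy0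
          change ((0 : E × E), (h, k - k')) ∈ P
          convert this using 2 <;> simp
        · simp
      · rintro ⟨⟨x', k'⟩, hk', ⟨z, k''⟩, ⟨hz, h, hk''⟩, heq⟩
        change k' = K l x' at hk'
        change z = 0 at hz
        subst hk' hz
        simp only [add_zero, Prod.mk.injEq] at heq
        obtain ⟨rfl, rfl⟩ := heq
        refine ⟨_, ⟨hA0 l hl x, by simp⟩, h, ?_⟩
        have := P.add_mem (hK l hl x) hk''
        change ((R l x, x + l • R l x), (h, K l x + k'')) ∈ P
        convert this using 2 <;> simp
  · -- (v)
    intro l hl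
    refine ⟨?_, ?_, ?_, ?_⟩
    · rw [hgc l hl]
      exact Set.eq_univ_of_forall fun x => ⟨G l x, rfl⟩
    · rw [hgc l hl]
      ext k
      simp [mulR]
    · rw [hgc l hl]
      refine ⟨‖G l‖, ?_⟩
      rintro ⟨x, k⟩ hk
      change k = G l x at hk
      subst hk
      exact ContinuousLinearMap.le_opNorm _ x
    · intro m hm h fm hfm
      rw [hgc m hm] at hfm
      change fm = G m h at hfm
      subst hfm
      refine ⟨R l (G m h), ⟨_, hA0 l hl (G m h), by simp⟩, ?_⟩
      rw [hgc l hl]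
      exact (hGid l m hl hm h).symm
  · -- (vi), first half
    intro l hl
    refine ⟨?_, ?_, hwdom l hl, ?_, ?_, ?_⟩
    · ext k
      constructor
      · intro hk
        exact hwu l hl 0 k 0 hk (hw0 _ _ P.zero_mem l)
      · rintro rfl
        exact hw0 _ _ P.zero_mem l
    · rw [hwdom l hl]; exact hd
    · rintro ⟨u, u'⟩ hu ⟨v, v'⟩ hv
      exact hws l u u' v v' hu hv
    · refine ⟨‖((2 : ℂ) * Complex.I)⁻¹ • ((l - (starRingEnd ℂ) l) • (K l ∘L G ((starRingEnd ℂ) l)))‖, ?_⟩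
      intro u u' v' hu hv
      rw [hwd l _ hl (hc l hl) u u' v' hu hv]
      exact ContinuousLinearMap.le_opNorm (((2 : ℂ) * Complex.I)⁻¹ •
        ((l - (starRingEnd ℂ) l) • (K l ∘L G ((starRingEnd ℂ) l)))) u
    · ext u
      constructor
      · rintro ⟨u', h1, h2⟩
        have h3 := hwd l _ hl (hc l hl) u u' u' h1 h2
        have hne : l - (starRingEnd ℂ) l ≠ 0 := by
          intro h
          have := congrArg Complex.im h
          simp only [Complex.sub_im, Complex.conj_im, Complex.zero_im] at this
          apply hl; linarith
        rw [sub_self] at h3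
        have h4 := (smul_eq_zero.mp h3.symm).resolve_left hne
        have h5 : G ((starRingEnd ℂ) l) u = 0 := by
          rw [← inner_self_eq_zero (𝕜 := ℂ)]
          nth_rewrite 2 [hGK]
          rw [Complex.conj_conj, ContinuousLinearMap.adjoint_inner_right, h4, inner_zero_left]
        rw [← hgker ((starRingEnd ℂ) l), hgf _ (hc l hl)]
        exact ⟨hwD' _ _ _ h1, h5.symm⟩
      · rintro ⟨u', hu⟩
        exact ⟨u', hw0 _ _ hu _, hw0 _ _ hu _⟩
  · -- (vi), second half
    intro m hm
    have hEs : Erel Γ m ⊆ adjR (Erel Γ m) := by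
      rintro ⟨u, w⟩ ⟨u1, u2, hu1, hu2, hw⟩ ⟨v, z⟩ ⟨v1, v2, hv1, hv2, hz⟩
      change w = _ at hw
      change z = _ at hz
      subst hw hz
      change ⟪u, (2 : ℂ)⁻¹ • (v1 + v2)⟫ = ⟪(2 : ℂ)⁻¹ • (u1 + u2), v⟫
      have h1 := hws m u u1 v v2 hu1 hv2
      have h2 := hws ((starRingEnd ℂ) m) u u2 v v1 hu2 (by rw [Complex.conj_conj]; exact hv1)
      rw [inner_smul_right, inner_smul_left, inner_add_left, inner_add_right, h1, h2]
      simp only [map_inv₀, map_ofNat]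
      ring
    have hEd : ∀ u ∈ D, ∃ w, (u, w) ∈ Erel Γ m := by
      intro u hu
      obtain ⟨u1, h1⟩ := hwD m hm u hu
      obtain ⟨u2, h2⟩ := hwD _ (hc m hm) u hu
      exact ⟨_, u1, u2, h1, h2, rfl⟩
    have hEd' : ∀ u w, (u, w) ∈ Erel Γ m → u ∈ D := by
      rintro u w ⟨u1, u2, h1, -, -⟩
      exact hwD' _ _ _ h1
    let m' := (starRingEnd ℂ) m
    let N : ℂ → F →L[ℂ] F := fun l =>
      (2 : ℂ)⁻¹ • ((l - m) • (K l ∘L G m) + (l - m') • (K l ∘L G m'))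
    have hN : ∀ l : ℂ, l.im ≠ 0 → ∀ u u' w, (u, u') ∈ weyl Γ l → (u, w) ∈ Erel Γ m →
        u' - w = N l u := by
      rintro l hl u u' w hu ⟨u1, u2, h1, h2, hw⟩
      change w = _ at hw
      have e1 := hwd l m hl hm u u' u1 hu h1
      have e2 := hwd l m' hl (hc m hm) u u' u2 hu h2
      change u' - w = (2 : ℂ)⁻¹ • ((l - m) • K l (G m u) + (l - m') • K l (G m' u))
      rw [← e1, ← e2, hw]
      module
    have hNadj : ∀ l : ℂ, l.im ≠ 0 →
        N ((starRingEnd ℂ) l) = ContinuousLinearMap.adjoint (N l) := by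
      intro l hl
      rw [ContinuousLinearMap.eq_adjoint_iff]
      have h1 : (fun p : F × F => ⟪N ((starRingEnd ℂ) l) p.1, p.2⟫) =
          fun p : F × F => ⟪p.1, N l p.2⟫ := by
        refine Continuous.ext_on (hd.prod hd) (by fun_prop) (by fun_prop) ?_
        rintro ⟨u, v⟩ ⟨hu, hv⟩
        obtain ⟨u', hu'⟩ := hwD _ (hc l hl) u hu
        obtain ⟨v', hv'⟩ := hwD l hl v hv
        obtain ⟨w, hw⟩ := hEd u hu
        obtain ⟨z, hz⟩ := hEd v hv
        change ⟪N ((starRingEnd ℂ) l) u, v⟫ = ⟪u, N l v⟫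
        rw [← hN l hl v v' z hv' hz, ← hN _ (hc l hl) u u' w hu' hw]
        have e1 := hws _ u u' v v' hu' (by rw [Complex.conj_conj]; exact hv')
        have e2 : ⟪u, z⟫ = ⟪w, v⟫ := hEs hw (v, z) hz
        rw [inner_sub_left, inner_sub_right, e1, e2]
      exact fun x y => congrFun h1 (x, y)
    refine ⟨?_, hEs, N, ⟨?_, hNadj, ?_⟩, ?_⟩
    · have : domR (Erel Γ m) = D := by
        ext u
        exact ⟨fun ⟨w, h⟩ => hEd' _ _ h, fun h => hEd u h⟩
      rw [this]; exact hd
    · intro l hl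
      have hl' : l.im ≠ 0 := hl
      have hRd : DifferentiableAt ℂ R l :=
        resolvent_diff R (fun a b ha hb x => (hKid a b ha hb x).1) l hl'
      have hopen : IsOpen {l : ℂ | l.im ≠ 0} := isOpen_ne_fun Complex.continuous_im continuous_const
      have hKd : DifferentiableAt ℂ K l := by
        have heq : K =ᶠ[𝓝 l] fun a => K m ∘L (ContinuousLinearMap.id ℂ E + (a - m) • R a) := by
          filter_upwards [hopen.mem_nhds hl'] with a ha
          ext x
          exact (hKid a m ha hm x).2
        refine DifferentiableAt.congr_of_eventuallyEq ?_ heq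
        refine DifferentiableAt.clm_comp (differentiableAt_const _) ?_
        fun_prop
      apply DifferentiableAt.differentiableWithinAt
      simp only [N]
      have h1 : DifferentiableAt ℂ (fun l => K l ∘L G m) l :=
        hKd.clm_comp (differentiableAt_const _)
      have h2 : DifferentiableAt ℂ (fun l => K l ∘L G m') l :=
        hKd.clm_comp (differentiableAt_const _)
      fun_prop
    · intro l hl u
      have hl' : l.im ≠ 0 := ne_of_gt hl
      have h1 : N l - N ((starRingEnd ℂ) l) =
          (l - (starRingEnd ℂ) l) • (K l ∘L G ((starRingEnd ℂ) l)) := by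
        refine clm_ext_dense hd _ _ fun v hv => ?_
        obtain ⟨v1, hv1⟩ := hwD l hl' v hv
        obtain ⟨v2, hv2⟩ := hwD _ (hc l hl') v hv
        obtain ⟨z, hz⟩ := hEd v hv
        change N l v - N ((starRingEnd ℂ) l) v = (l - (starRingEnd ℂ) l) • K l (G ((starRingEnd ℂ) l) v)
        rw [← hN l hl' v v1 z hv1 hz, ← hN _ (hc l hl') v v2 z hv2 hz,
          ← hwd l _ hl' (hc l hl') v v1 v2 hv1 hv2]
        abel
      have h2 : ⟪u, N l u⟫ - ⟪u, N ((starRingEnd ℂ) l) u⟫ =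
          (l - (starRingEnd ℂ) l) * ((‖G ((starRingEnd ℂ) l) u‖ : ℂ) ^ 2) := by
        rw [← inner_sub_right]
        have h3 : N l u - N ((starRingEnd ℂ) l) u =
            (l - (starRingEnd ℂ) l) • K l (G ((starRingEnd ℂ) l) u) := by
          have := congrArg (fun L : F →L[ℂ] F => L u) h1
          exact this
        rw [h3, inner_smul_right]
        congr 1
        rw [← ContinuousLinearMap.adjoint_inner_left]
        have h4 := hGK ((starRingEnd ℂ) l)
        rw [Complex.conj_conj] at h4
        rw [← h4]
        exact inner_self_eq_norm_sq_to_K _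
      rw [hNadj l hl', ContinuousLinearMap.adjoint_inner_right, ← inner_conj_symm (N l u) u] at h2
      have h5 := congrArg Complex.im h2
      rw [← Complex.ofReal_pow, Complex.im_mul_ofReal] at h5
      simp only [Complex.sub_im, Complex.conj_im] at h5
      nlinarith [sq_nonneg ‖G ((starRingEnd ℂ) l) u‖, mul_nonneg hl.le (sq_nonneg ‖ContinuousLinearMap.adjoint (N l) u‖), mul_nonneg hl.le (sq_nonneg ‖G ((starRingEnd ℂ) l) u‖)]
    · intro l hl
      rw [← graph_closure hd (N l)]
      congr 1
      ext ⟨u, v⟩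
      constructor
      · rintro ⟨u', w, h1, h2, h3⟩
        exact ⟨hEd' _ _ h2, h3.trans (hN l hl u u' w h1 h2)⟩
      · rintro ⟨h1, h2⟩
        obtain ⟨u', hu'⟩ := hwD l hl u h1
        obtain ⟨w, hw⟩ := hEd u h1
        exact ⟨u', w, hu', hw, h2.trans (hN l hl u u' w hu' hw).symm⟩

end BT
end
end

section
/- Let {𝓗,Γ} be a B-generalized boundary pair for A* with Weyl function M and γ-field γ, and let E be a densely defined symmetric operator in 𝓗. Define Γ̃ := {((f,f'),(h, Eh + h')) : ((f,f'),(h,h')) ∈ Γ, h ∈ dom E}. Then {𝓗,Γ̃} is an AB-generalized boundary pair for A*; its Weyl function is M̃(λ) = E + M(λ) restricted to dom E and its γ-field is γ̃(λ) = γ(λ) restricted to dom E, for λ ∈ ℂ∖ℝ. Moreover, Γ̃ is closed (as a subspace of (𝔥×𝔥)×(𝓗×𝓗)) if and only if E is a closed operator, and the closure of Γ̃ is given by the same formula with E replaced by its closure. Conversely, if {𝓗,Γ̃} is any AB-generalized boundary pair for A*, then there exist a B-generalized boundary pair {𝓗,Γ} for A* and a densely defined symmetric operator E in 𝓗 such that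 Γ̃ = {((f,f'),(h, Eh + h')) : ((f,f'),(h,h')) ∈ Γ, h ∈ dom E}. -/
noncomputable section

open Filter Topology

namespace BT

local notation "⟪" x ", " y "⟫" => @inner ℂ _ _ x y

section Helpers

variable {E F : Type*} [NormedAddCommGroup E] [InnerProductSpace ℂ E]
  [NormedAddCommGroup F] [InnerProductSpace ℂ F]

lemma IsLinRel.add_mem' {M : Type*} [AddCommGroup M] [Module ℂ M] {s : Set M} (h : IsLinRel s)
    {x y : M} (hx : x ∈ s) (hy : y ∈ s) : x + y ∈ s := by
  obtain ⟨p, rfl⟩ := h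
  exact p.add_mem hx hy

lemma IsLinRel.sub_mem' {M : Type*} [AddCommGroup M] [Module ℂ M] {s : Set M} (h : IsLinRel s)
    {x y : M} (hx : x ∈ s) (hy : y ∈ s) : x - y ∈ s := by
  obtain ⟨p, rfl⟩ := h
  exact p.sub_mem hx hy

lemma IsLinRel.smul_mem' {M : Type*} [AddCommGroup M] [Module ℂ M] {s : Set M} (h : IsLinRel s)
    (c : ℂ) {x : M} (hx : x ∈ s) : c • x ∈ s := by
  obtain ⟨p, rfl⟩ := h
  exact p.smul_mem c hx

lemma IsLinRel.zero_mem' {M : Type*} [AddCommGroup M] [Module ℂ M] {s : Set M} (h : IsLinRel s) :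
    (0 : M) ∈ s := by
  obtain ⟨p, rfl⟩ := h
  exact p.zero_mem

lemma isLinRel_of {M : Type*} [AddCommGroup M] [Module ℂ M] {s : Set M} (h0 : (0 : M) ∈ s)
    (ha : ∀ x ∈ s, ∀ y ∈ s, x + y ∈ s) (hs : ∀ (c : ℂ), ∀ x ∈ s, c • x ∈ s) : IsLinRel s :=
  ⟨{ carrier := s, zero_mem' := h0, add_mem' := fun hx hy => ha _ hx _ hy,
     smul_mem' := fun c x hx => hs c x hx }, rfl⟩

lemma isLinRel_adjR (S : Set (F × E)) : IsLinRel (adjR S) := by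
  refine isLinRel_of ?_ ?_ ?_
  · intro q _; simp
  · intro x hx y hy q hq
    simp only [Prod.fst_add, Prod.snd_add, inner_add_left, hx q hq, hy q hq]
  · intro c x hx q hq
    simp only [Prod.smul_fst, Prod.smul_snd, inner_smul_left, hx q hq]

lemma isClosed_adjR (S : Set (F × E)) : IsClosed (adjR S) := by
  have : adjR S = ⋂ q ∈ S, {p : E × F | ⟪p.1, q.2⟫ = ⟪p.2, q.1⟫} := by
    ext p; simp [adjR]
  rw [this]
  refine isClosed_biInter fun q _ => isClosed_eq ?_ ?_ <;> fun_prop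

lemma dense_inner_eq {D : Set F} (hD : Dense D) {x y : F} (h : ∀ d ∈ D, ⟪d, x⟫ = ⟪d, y⟫) :
    x = y := by
  have : Set.EqOn (fun d => ⟪d, x⟫) (fun d => ⟪d, y⟫) D := fun d hd => h d hd
  have h2 := Continuous.ext_on hD (by fun_prop) (by fun_prop) this
  exact ext_inner_left ℂ fun v => congrFun h2 v

lemma sym_norm {T : Set (E × E)} (hT : T ⊆ adjR T) {s : ℂ} (hs : s = Complex.I ∨ s = -Complex.I)
    {p : E × E} (hp : p ∈ T) : ‖p.2 - s • p.1‖ ^ 2 = ‖p.2‖ ^ 2 + ‖p.1‖ ^ 2 := by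
  have h := hT hp p hp
  rw [@norm_sub_sq ℂ]
  have h1 : RCLike.re ⟪p.2, s • p.1⟫ = 0 := by
    have him : (⟪p.2, p.1⟫).im = 0 := by
      have h3 := congrArg Complex.im (inner_conj_symm (𝕜 := ℂ) p.2 p.1)
      rw [h, Complex.conj_im] at h3
      linarith
    rw [inner_smul_right]
    rcases hs with rfl | rfl <;> simp [him]
  have h2 : ‖s • p.1‖ = ‖p.1‖ := by
    rw [norm_smul]; rcases hs with rfl | rfl <;> simp
  rw [h1, h2]; ring

lemma selfadj_surj [CompleteSpace E] {T : Set (E × E)} (hT : T = adjR T) {s : ℂ}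
    (hs : s = Complex.I ∨ s = -Complex.I) (u : E) : ∃ p ∈ T, p.2 - s • p.1 = u := by
  have hcl : IsClosed T := hT ▸ isClosed_adjR T
  obtain ⟨P, hP⟩ : IsLinRel T := hT ▸ isLinRel_adjR T
  have hsym : T ⊆ adjR T := hT.subset
  let L : P →L[ℂ] E := ((ContinuousLinearMap.snd ℂ E E) - s • (ContinuousLinearMap.fst ℂ E E)).comp
    P.subtypeL
  have hL : ∀ x : P, L x = x.1.2 - s • x.1.1 := fun x => rfl
  have hPc : IsClosed (P : Set (E × E)) := hP ▸ hcl
  have : CompleteSpace P := hPc.completeSpace_coe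
  have hanti : AntilipschitzWith 1 L := by
    refine AddMonoidHomClass.antilipschitz_of_bound L fun x => ?_
    have hx : (x : E × E) ∈ T := hP ▸ x.2
    have h := sym_norm hsym hs hx
    rw [← hL] at h
    have : ‖x‖ = max ‖x.1.1‖ ‖x.1.2‖ := rfl
    rw [this]
    simp only [NNReal.coe_one, one_mul]
    refine max_le ?_ ?_
    · exact le_of_sq_le_sq (by nlinarith [sq_nonneg ‖x.1.2‖]) (norm_nonneg _)
    · exact le_of_sq_le_sq (by nlinarith [sq_nonneg ‖x.1.1‖]) (norm_nonneg _)
  have hcomp : IsComplete (Set.range L) := hanti.isComplete_range L.uniformContinuous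
  let R : Submodule ℂ E := LinearMap.range (L : P →ₗ[ℂ] E)
  have hR : (R : Set E) = Set.range L := by ext; simp [R]
  have : CompleteSpace R := by
    have : IsComplete (R : Set E) := hR ▸ hcomp
    exact this.completeSpace_coe
  have hbot : Rᗮ = ⊥ := by
    rw [Submodule.eq_bot_iff]
    intro v hv
    rw [Submodule.mem_orthogonal'] at hv
    have hs2 : (starRingEnd ℂ) s = -s := by rcases hs with rfl | rfl <;> simp
    have hv' : (v, (-s) • v) ∈ T := by
      rw [hT]
      intro q hq
      have hq' : q ∈ P := by rw [← SetLike.mem_coe, hP]; exact hq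
      have := hv (L ⟨q, hq'⟩) ⟨⟨q, hq'⟩, rfl⟩
      rw [hL] at this
      simp only [inner_sub_right, inner_smul_right] at this
      simp only [inner_smul_left, map_neg, hs2, neg_neg]
      linear_combination this
    have h1 := sym_norm hsym (s := -s) (by rcases hs with rfl | rfl <;> simp) hv'
    simp only [sub_self, norm_zero] at h1
    have : ‖v‖ ^ 2 = 0 := by nlinarith [sq_nonneg ‖v‖, sq_nonneg ‖(-s) • v‖]
    simpa using this
  have htop : R = ⊤ := by rwa [Submodule.orthogonal_eq_bot_iff] at hbot
  have hu : u ∈ R := htop ▸ Submodule.mem_top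
  obtain ⟨x, hx⟩ := hu
  exact ⟨x.1, hP ▸ x.2, hx⟩

/-- the operator `K = γ(i)*`. -/
lemma exists_K [CompleteSpace E] [CompleteSpace F] {Γ : Set ((E × E) × (F × F))}
    (hlin : IsLinRel Γ) (hG : GreenPair Γ)
    (hd : Dense (ranR (G0 Γ))) (hA0 : A0 Γ = adjR (A0 Γ)) :
    ∃ K : E →L[ℂ] F, (∀ g k, (g, ((0 : F), k)) ∈ Γ → k = K (g.2 + Complex.I • g.1)) ∧
      (∀ f h h', ((f, Complex.I • f), (h, h')) ∈ Γ → f = ContinuousLinearMap.adjoint K h) ∧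
      (∀ h ∈ ranR (G0 Γ), ∃ f h', ((f, Complex.I • f), (h, h')) ∈ Γ) := by
  have hD : ∀ h ∈ ranR (G0 Γ), ∃ f h', ((f, Complex.I • f), (h, h')) ∈ Γ := by
    rintro h ⟨p, h', hp⟩
    obtain ⟨g, ⟨k, hk⟩, hgp⟩ := selfadj_surj hA0 (Or.inl rfl) (p.2 - Complex.I • p.1)
    refine ⟨p.1 - g.1, h' - k, ?_⟩
    have hf2 : p.2 - g.2 = Complex.I • (p.1 - g.1) := by
      rw [smul_sub]
      rw [sub_eq_sub_iff_add_eq_add] at hgp ⊢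
      exact hgp.symm.trans (add_comm _ _)
    have := hlin.sub_mem' hp hk
    convert this using 1
    ext <;> simp [← hf2]
  have hgreen : ∀ g k, (g, ((0 : F), k)) ∈ Γ → ∀ f h h', ((f, Complex.I • f), (h, h')) ∈ Γ →
      ⟪h, k⟫ = ⟪f, g.2 + Complex.I • g.1⟫ := by
    intro g k hk f h h' hf
    have := hG _ hk _ hf
    simp only [inner_smul_left, inner_zero_right, Complex.conj_I] at this
    rw [inner_add_right, inner_smul_right]
    linear_combination -this
  have huniq : ∀ u v v', (∀ f h h', ((f, Complex.I • f), (h, h')) ∈ Γ → ⟪h, v⟫ = ⟪f, u⟫) →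
      (∀ f h h', ((f, Complex.I • f), (h, h')) ∈ Γ → ⟪h, v'⟫ = ⟪f, u⟫) → v = v' := by
    intro u v v' h1 h2
    refine dense_inner_eq hd fun d hd => ?_
    obtain ⟨f, h', hf⟩ := hD d hd
    rw [h1 _ _ _ hf, h2 _ _ _ hf]
  have hex : ∀ u : E, ∃ v : F, ∀ f h h', ((f, Complex.I • f), (h, h')) ∈ Γ →
      ⟪h, v⟫ = ⟪f, u⟫ := by
    intro u
    obtain ⟨g, ⟨k, hk⟩, hgp⟩ := selfadj_surj hA0 (Or.inr rfl) u
    refine ⟨k, fun f h h' hf => ?_⟩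
    rw [hgreen g k hk f h h' hf, ← hgp, neg_smul, sub_neg_eq_add]
  choose K0 hK0 using hex
  let K1 : E →ₗ[ℂ] F :=
    { toFun := K0
      map_add' := fun x y => huniq (x + y) _ _ (hK0 _) fun f h h' hf => by
        rw [inner_add_right, inner_add_right, hK0 x _ _ _ hf, hK0 y _ _ _ hf]
      map_smul' := fun c x => huniq (c • x) _ _ (hK0 _) fun f h h' hf => by
        rw [RingHom.id_apply, inner_smul_right, inner_smul_right, hK0 x _ _ _ hf] }
  have hcont : Continuous K1 := by
    refine K1.continuous_of_seq_closed_graph fun u x y hu hy => ?_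
    refine huniq x _ _ ?_ (hK0 x)
    intro f h h' hf
    have t1 : Tendsto (fun n => ⟪h, K1 (u n)⟫) atTop (𝓝 ⟪h, y⟫) :=
      Tendsto.inner tendsto_const_nhds hy
    have t2 : Tendsto (fun n => ⟪f, u n⟫) atTop (𝓝 ⟪f, x⟫) :=
      Tendsto.inner tendsto_const_nhds hu
    refine tendsto_nhds_unique t1 (t2.congr fun n => ?_)
    exact (hK0 (u n) _ _ _ hf).symm
  let K : E →L[ℂ] F := ⟨K1, hcont⟩
  have hK : ∀ u, K u = K0 u := fun _ => rfl
  refine ⟨K, ?_, ?_, hD⟩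
  · intro g k hk
    exact huniq _ _ _ (hgreen g k hk) (hK0 _)
  · intro f h h' hf
    refine ext_inner_right ℂ fun v => ?_
    rw [ContinuousLinearMap.adjoint_inner_left, hK, hK0 v _ _ _ hf]

section
variable [CompleteSpace E] [CompleteSpace F]

/-- The triangular parametrization. -/
def Phi (K : E →L[ℂ] F) (M : F →L[ℂ] F) : ((E × E) × (F × F)) ≃ₜ ((E × E) × (F × F)) where
  toFun p := ((p.1.1 + ContinuousLinearMap.adjoint K p.2.1,
      p.1.2 + Complex.I • ContinuousLinearMap.adjoint K p.2.1),
    (p.2.1, p.2.2 + (K (p.1.2 + Complex.I • p.1.1) + M p.2.1)))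
  invFun p := ((p.1.1 - ContinuousLinearMap.adjoint K p.2.1,
      p.1.2 - Complex.I • ContinuousLinearMap.adjoint K p.2.1),
    (p.2.1, p.2.2 - (K ((p.1.2 - Complex.I • ContinuousLinearMap.adjoint K p.2.1) +
      Complex.I • (p.1.1 - ContinuousLinearMap.adjoint K p.2.1)) + M p.2.1)))
  left_inv p := by ext <;> simp
  right_inv p := by ext <;> simp
  continuous_toFun := by fun_prop
  continuous_invFun := by fun_prop

lemma Phi_apply (K : E →L[ℂ] F) (M : F →L[ℂ] F) (g g' : E) (h w : F) :
    Phi K M ((g, g'), (h, w)) = ((g + ContinuousLinearMap.adjoint K h,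
      g' + Complex.I • ContinuousLinearMap.adjoint K h),
      (h, w + (K (g' + Complex.I • g) + M h))) := rfl

lemma rep {Γ : Set ((E × E) × (F × F))}
    (hlin : IsLinRel Γ) (hA0 : A0 Γ = adjR (A0 Γ)) (K : E →L[ℂ] F) (M : F →L[ℂ] F)
    (h1 : ∀ g k, (g, ((0 : F), k)) ∈ Γ → k = K (g.2 + Complex.I • g.1))
    (h2 : ∀ f h h', ((f, Complex.I • f), (h, h')) ∈ Γ → f = ContinuousLinearMap.adjoint K h) :
    Γ = Phi K M '' (A0 Γ ×ˢ {p | (p.1, p.2 + M p.1) ∈ weyl Γ Complex.I}) := by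
  ext ⟨p, h, h'⟩
  constructor
  · intro hp
    obtain ⟨g, ⟨k, hk⟩, hgp⟩ := selfadj_surj hA0 (Or.inl rfl) (p.2 - Complex.I • p.1)
    have hsub := hlin.sub_mem' hp hk
    have hf2 : p.2 - g.2 = Complex.I • (p.1 - g.1) := by
      rw [smul_sub]
      rw [sub_eq_sub_iff_add_eq_add] at hgp ⊢
      exact hgp.symm.trans (add_comm _ _)
    have hf : ((p.1 - g.1, Complex.I • (p.1 - g.1)), (h, h' - k)) ∈ Γ := by
      convert hsub using 1
      ext <;> simp [← hf2]
    refine ⟨(g, (h, h' - k - M h)), ⟨⟨k, hk⟩, ⟨p.1 - g.1, ?_⟩⟩, ?_⟩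
    · simpa using hf
    · have e1 := h2 _ _ _ hf
      have e2 := h1 _ _ hk
      obtain ⟨g, g'⟩ := g
      rw [Phi_apply, ← e1, ← hf2, ← e2]
      ext <;> simp
  · rintro ⟨⟨⟨g, g'⟩, ⟨a, w⟩⟩, ⟨⟨k, hk⟩, ⟨f, hf⟩⟩, heq⟩
    rw [← heq, Phi_apply]
    have e1 := h2 _ _ _ hf
    have e2 := h1 _ _ hk
    have := hlin.add_mem' hk hf
    simp only at e1 e2
    rw [← e1, ← e2]
    convert this using 1
    ext <;> simp
    abel

lemma tri_Phi (K : E →L[ℂ] F) (M : F →L[ℂ] F) (T : Set (E × E)) (e : Set (F × F)) :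
    triTransform (Phi K M '' (T ×ˢ {p | p.2 = 0})) e = Phi K M '' (T ×ˢ e) := by
  ext ⟨p, q⟩
  constructor
  · rintro ⟨h, h', w, ⟨⟨⟨g, g'⟩, ⟨a, b⟩⟩, ⟨hg, hb⟩, heq⟩, hw, hq⟩
    simp only [Set.mem_ofPred_eq] at hb
    subst hb
    rw [Phi_apply] at heq
    simp only [Prod.mk.injEq] at heq hq
    obtain ⟨rfl, rfl, rfl⟩ := heq
    refine ⟨((g, g'), (a, w)), ⟨hg, hw⟩, ?_⟩
    rw [Phi_apply, hq]
    simp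
  · rintro ⟨⟨⟨g, g'⟩, ⟨a, w⟩⟩, ⟨hg, hw⟩, heq⟩
    rw [Phi_apply] at heq
    simp only [Prod.mk.injEq] at heq
    obtain ⟨rfl, rfl⟩ := heq
    refine ⟨a, K (g' + Complex.I • g) + M a, w, ⟨((g, g'), (a, 0)), ⟨hg, rfl⟩, ?_⟩, hw, rfl⟩
    rw [Phi_apply]
    simp

lemma green_weyl {Γ : Set ((E × E) × (F × F))} (hG : GreenPair Γ) (K : E →L[ℂ] F)
    (h2 : ∀ f h h', ((f, Complex.I • f), (h, h')) ∈ Γ → f = ContinuousLinearMap.adjoint K h)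
    {h h' k k' : F} (hh : (h, h') ∈ weyl Γ Complex.I) (hk : (k, k') ∈ weyl Γ Complex.I) :
    ⟪k, h'⟫ - ⟪k', h⟫ = 2 * Complex.I *
      ⟪ContinuousLinearMap.adjoint K k, ContinuousLinearMap.adjoint K h⟫ := by
  obtain ⟨f, hf⟩ := hh
  obtain ⟨g, hg⟩ := hk
  have := hG _ hf _ hg
  simp only [inner_smul_left, inner_smul_right, Complex.conj_I] at this
  rw [← h2 _ _ _ hf, ← h2 _ _ _ hg]
  linear_combination -this

lemma B_rep {A : Set (E × E)} {Γ : Set ((E × E) × (F × F))} (hB : IsBPair A Γ) :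
    ∃ (K : E →L[ℂ] F) (M : F →L[ℂ] F), Γ = Phi K M '' (A0 Γ ×ˢ {p | p.2 = 0}) := by
  obtain ⟨⟨⟨hlin, -, hG⟩, -, hd, hA0⟩, huniv⟩ := hB
  obtain ⟨K, h1, h2, h3⟩ := exists_K hlin hG hd hA0
  have hex : ∀ h : F, ∃ h', (h, h') ∈ weyl Γ Complex.I := by
    intro h
    obtain ⟨f, h', hf⟩ := h3 h (huniv ▸ Set.mem_univ h)
    exact ⟨h', f, hf⟩
  have huniq : ∀ h a b, (h, a) ∈ weyl Γ Complex.I → (h, b) ∈ weyl Γ Complex.I → a = b := by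
    intro h a b ha hb
    obtain ⟨f, hf⟩ := ha
    obtain ⟨g, hg⟩ := hb
    have e : f = g := (h2 _ _ _ hf).trans (h2 _ _ _ hg).symm
    subst e
    have := hlin.sub_mem' hf hg
    simp only [Prod.mk_sub_mk, sub_self] at this
    have := h1 _ _ this
    simpa [sub_eq_zero] using this
  choose M0 hM0 using hex
  let M1 : F →ₗ[ℂ] F :=
    { toFun := M0
      map_add' := fun x y => by
        refine huniq (x + y) _ _ (hM0 _) ?_
        obtain ⟨f, hf⟩ := hM0 x
        obtain ⟨g, hg⟩ := hM0 y
        refine ⟨f + g, ?_⟩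
        simpa using hlin.add_mem' hf hg
      map_smul' := fun c x => by
        refine huniq (c • x) _ _ (hM0 _) ?_
        obtain ⟨f, hf⟩ := hM0 x
        refine ⟨c • f, ?_⟩
        simpa [smul_comm c Complex.I] using hlin.smul_mem' c hf }
  have hcont : Continuous M1 := by
    refine M1.continuous_of_seq_closed_graph fun u x y hu hy => ?_
    refine ext_inner_left ℂ fun k => ?_
    have t1 : Tendsto (fun n => ⟪k, M1 (u n)⟫ - ⟪M0 k, u n⟫) atTop (𝓝 (⟪k, y⟫ - ⟪M0 k, x⟫)) :=
      (Tendsto.inner tendsto_const_nhds hy).sub (Tendsto.inner tendsto_const_nhds hu)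
    have t2 : Tendsto (fun n => 2 * Complex.I *
      ⟪ContinuousLinearMap.adjoint K k, ContinuousLinearMap.adjoint K (u n)⟫) atTop
      (𝓝 (2 * Complex.I *
        ⟪ContinuousLinearMap.adjoint K k, ContinuousLinearMap.adjoint K x⟫)) :=
      Tendsto.const_mul _ (Tendsto.inner tendsto_const_nhds
        (((ContinuousLinearMap.adjoint K).continuous.tendsto x).comp hu))
    have t3 := tendsto_nhds_unique t1 (t2.congr fun n =>
      (green_weyl hG K h2 (hM0 (u n)) (hM0 k)).symm)
    rw [← green_weyl hG K h2 (hM0 x) (hM0 k)] at t3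
    exact sub_left_injective t3
  let M : F →L[ℂ] F := ⟨M1, hcont⟩
  have hM : ∀ u, M u = M0 u := fun _ => rfl
  refine ⟨K, M, ?_⟩
  have := rep hlin hA0 K M h1 h2
  have hset : {p : F × F | (p.1, p.2 + M p.1) ∈ weyl Γ Complex.I} = {p | p.2 = 0} := by
    ext ⟨h, w⟩
    simp only [Set.mem_ofPred_eq]
    constructor
    · intro hw
      have := huniq _ _ _ hw (hM0 h)
      rw [hM] at this
      simpa using this
    · rintro rfl
      rw [hM, zero_add]
      exact hM0 h
  rwa [hset] at this

/-- the domain does not change its closure when the second parameter is restricted to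
a dense set. -/
lemma closure_dom (K : E →L[ℂ] F) (M : F →L[ℂ] F) (T : Set (E × E)) (e : Set (F × F))
    (he : Dense (domR e)) :
    domR (Phi K M '' (T ×ˢ {p | p.2 = 0})) ⊆ closure (domR (Phi K M '' (T ×ˢ e))) := by
  rintro p ⟨q, ⟨⟨⟨g, g'⟩, ⟨a, b⟩⟩, ⟨hg, hb⟩, heq⟩⟩
  rw [Phi_apply] at heq
  simp only [Prod.mk.injEq] at heq
  obtain ⟨rfl, rfl⟩ := heq
  let φ : F → E × E := fun h => (g + ContinuousLinearMap.adjoint K h,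
      g' + Complex.I • ContinuousLinearMap.adjoint K h)
  have hφ : Continuous φ := by fun_prop
  change φ a ∈ _
  refine closure_mono ?_ (image_closure_subset_closure_image hφ ⟨a, he a, rfl⟩)
  rintro _ ⟨h, ⟨w, hw⟩, rfl⟩
  exact ⟨_, ⟨((g, g'), (h, w)), ⟨hg, hw⟩, rfl⟩⟩

lemma AB_of_B {A : Set (E × E)} {Γ : Set ((E × E) × (F × F))} (hB : IsBPair A Γ)
    {e : Set (F × F)} (he1 : IsLinRel e) (he2 : Dense (domR e)) (he3 : e ⊆ adjR e) :
    IsABPair A (triTransform Γ e) := by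
  obtain ⟨K, M, hrep⟩ := B_rep hB
  obtain ⟨⟨⟨hlin, hdom, hG⟩, hdd, hd, hA0⟩, huniv⟩ := hB
  have hsub : domR (triTransform Γ e) ⊆ domR Γ := by
    rintro p ⟨q, h, h', w, hp, -⟩
    exact ⟨_, hp⟩
  have hA : A0 (triTransform Γ e) = A0 Γ := by
    ext p
    constructor
    · rintro ⟨q, h, h', w, hp, hw, heq⟩
      simp only [Prod.mk.injEq] at heq
      obtain ⟨rfl, rfl⟩ := heq
      exact ⟨_, hp⟩
    · rintro ⟨q, hp⟩
      exact ⟨0 + q, 0, q, 0, hp, he1.zero_mem', rfl⟩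
  refine ⟨⟨?_, hsub.trans hdom, ?_⟩, ?_, ?_, ?_⟩
  · refine isLinRel_of ?_ ?_ ?_
    · exact ⟨0, 0, 0, hlin.zero_mem', he1.zero_mem', by ext <;> simp⟩
    · rintro ⟨x, _⟩ ⟨h, h', w, hp, hw, rfl⟩ ⟨y, _⟩ ⟨k, k', v, hq, hv, rfl⟩
      refine ⟨h + k, h' + k', w + v, hlin.add_mem' hp hq, he1.add_mem' hw hv, ?_⟩
      ext <;> simp
      abel
    · rintro c ⟨x, _⟩ ⟨h, h', w, hp, hw, rfl⟩
      refine ⟨c • h, c • h', c • w, hlin.smul_mem' c hp, he1.smul_mem' c hw, ?_⟩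
      ext <;> simp
  · rintro ⟨x, _⟩ ⟨h, h', w, hp, hw, rfl⟩ ⟨y, _⟩ ⟨k, k', v, hq, hv, rfl⟩
    have g1 := hG _ hp _ hq
    have g2 := he3 hv _ hw
    simp only [inner_add_left, inner_add_right] at g1 g2 ⊢
    linear_combination g1 - g2
  · refine (closure_mono hsub).trans hdd.subset |>.antisymm ?_
    rw [← hdd]
    refine closure_minimal ?_ isClosed_closure
    have := closure_dom K M (A0 Γ) e he2
    have hk : Phi K M '' (A0 Γ ×ˢ e) = triTransform Γ e := by rw [← tri_Phi, ← hrep]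
    rwa [hk, ← hrep] at this
  · refine he2.mono ?_
    rintro h ⟨w, hw⟩
    obtain ⟨p, h', hp⟩ : h ∈ ranR (G0 Γ) := huniv ▸ Set.mem_univ h
    exact ⟨p, w + h', h, h', w, hp, hw, rfl⟩
  · rw [hA]; exact hA0

set_option maxHeartbeats 1000000 in
lemma converse {A : Set (E × E)} {Γ : Set ((E × E) × (F × F))} (hAB : IsABPair A Γ) :
    ∃ (Γ₀ : Set ((E × E) × (F × F))) (e₀ : Set (F × F)),
        IsBPair A Γ₀ ∧ IsLinRel e₀ ∧ Dense (domR e₀) ∧ e₀ ⊆ adjR e₀ ∧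
        Γ = triTransform Γ₀ e₀ := by
  obtain ⟨⟨hlin, hdom, hG⟩, hdd, hd, hA0⟩ := hAB
  obtain ⟨K, h1, h2, h3⟩ := exists_K hlin hG hd hA0
  let M : F →L[ℂ] F := Complex.I • (K.comp (ContinuousLinearMap.adjoint K))
  have hM : ∀ h, M h = Complex.I • K (ContinuousLinearMap.adjoint K h) := fun _ => rfl
  have hL : ∀ x y, ⟪ContinuousLinearMap.adjoint K x, ContinuousLinearMap.adjoint K y⟫ =
      ⟪x, K (ContinuousLinearMap.adjoint K y)⟫ := fun x y =>
    ContinuousLinearMap.adjoint_inner_left K _ _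
  have hR : ∀ x y, ⟪ContinuousLinearMap.adjoint K x, ContinuousLinearMap.adjoint K y⟫ =
      ⟪K (ContinuousLinearMap.adjoint K x), y⟫ := fun x y =>
    ContinuousLinearMap.adjoint_inner_right K _ _
  have hrep := rep hlin hA0 K M h1 h2
  set e₀ : Set (F × F) := {p | (p.1, p.2 + M p.1) ∈ weyl Γ Complex.I} with he₀
  set Γ₀ := Phi K M '' (A0 Γ ×ˢ {p | p.2 = 0}) with hΓ₀
  have htri : Γ = triTransform Γ₀ e₀ := by rw [hΓ₀, tri_Phi]; exact hrep
  have hdense : Dense (domR e₀) := by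
    refine hd.mono ?_
    intro h hh
    obtain ⟨f, h', hf⟩ := h3 h hh
    exact ⟨h' - M h, f, by simpa using hf⟩
  have hA0lin : IsLinRel (A0 Γ) := hA0 ▸ isLinRel_adjR _
  have hsub1 : domR Γ ⊆ domR Γ₀ := by
    rw [htri]
    rintro p ⟨q, h, h', w, hp, -⟩
    exact ⟨_, hp⟩
  have hsub2 : domR Γ₀ ⊆ adjR A := by
    have := closure_dom K M (A0 Γ) e₀ hdense
    rw [← hrep, hdd] at this
    exact this
  have hA0' : A0 Γ₀ = A0 Γ := by
    ext p
    constructor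
    · rintro ⟨q, ⟨⟨g, g'⟩, ⟨a, b⟩⟩, ⟨hg, hb⟩, heq⟩
      rw [Phi_apply] at heq
      simp only [Prod.mk.injEq] at heq
      obtain ⟨rfl, rfl, rfl⟩ := heq
      simpa using hg
    · intro hp
      obtain ⟨g, g'⟩ := p
      refine ⟨K (g' + Complex.I • g), ⟨((g, g'), (0, 0)), ⟨hp, rfl⟩, ?_⟩⟩
      rw [Phi_apply]
      simp
  have huniv : ranR (G0 Γ₀) = Set.univ := by
    refine Set.eq_univ_of_forall fun h => ?_
    exact ⟨_, _, ((0, 0), (h, 0)), ⟨hA0lin.zero_mem', rfl⟩, rfl⟩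
  refine ⟨Γ₀, e₀, ⟨⟨⟨?_, hsub2, ?_⟩, ?_, ?_, ?_⟩, huniv⟩, ?_, hdense, ?_, htri⟩
  · refine isLinRel_of ?_ ?_ ?_
    · exact ⟨0, ⟨hA0lin.zero_mem', rfl⟩, by ext <;> simp [Phi]⟩
    · rintro _ ⟨⟨⟨g, g'⟩, ⟨a, b⟩⟩, ⟨hg, hb⟩, rfl⟩ _ ⟨⟨⟨k, k'⟩, ⟨c, d⟩⟩, ⟨hk, hd⟩, rfl⟩
      refine ⟨((g, g'), (a, b)) + ((k, k'), (c, d)), ⟨hA0lin.add_mem' hg hk, ?_⟩, ?_⟩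
      · simp only [Set.mem_ofPred_eq] at hb hd ⊢
        simp [hb, hd]
      · ext <;> simp [Phi] <;> abel
    · rintro c _ ⟨⟨⟨g, g'⟩, ⟨a, b⟩⟩, ⟨hg, hb⟩, rfl⟩
      refine ⟨c • ((g, g'), (a, b)), ⟨hA0lin.smul_mem' c hg, ?_⟩, ?_⟩
      · simp only [Set.mem_ofPred_eq] at hb ⊢
        simp [hb]
      · ext <;> simp [Phi, smul_comm c Complex.I]
  · rintro _ ⟨⟨⟨g, g'⟩, ⟨a, b⟩⟩, ⟨hg, hb⟩, rfl⟩ _ ⟨⟨⟨k, k'⟩, ⟨c, d⟩⟩, ⟨hk, hd⟩, rfl⟩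
    simp only [Set.mem_ofPred_eq] at hb hd
    subst hb hd
    have hs := hA0.subset hk _ hg
    simp only at hs
    simp only [Phi_apply, hM, zero_add, inner_add_left, inner_add_right, inner_smul_left,
      inner_smul_right, map_add, map_smul, Complex.conj_I,
      ContinuousLinearMap.adjoint_inner_left, ContinuousLinearMap.adjoint_inner_right]
    have hX := (hL c a).symm.trans (hR c a)
    first
    | linear_combination hs + Complex.I * hX
    | linear_combination hs - Complex.I * hX
    | linear_combination -hs + Complex.I * hX
    | linear_combination -hs - Complex.I * hX
  · refine (closure_minimal hsub2 (isClosed_adjR A)).antisymm ?_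
    rw [← hdd]
    exact closure_mono hsub1
  · rw [huniv]; exact dense_univ
  · rw [hA0']; exact hA0
  · refine isLinRel_of ?_ ?_ ?_
    · refine ⟨0, ?_⟩
      convert hlin.zero_mem' using 1
      ext <;> simp
    · rintro ⟨x, x'⟩ ⟨f, hf⟩ ⟨y, y'⟩ ⟨g, hg⟩
      refine ⟨f + g, ?_⟩
      convert hlin.add_mem' hf hg using 1
      ext <;> simp
      abel
    · rintro c ⟨x, x'⟩ ⟨f, hf⟩
      refine ⟨c • f, ?_⟩
      convert hlin.smul_mem' c hf using 1
      ext <;> simp [smul_comm c Complex.I]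
  · rintro ⟨x, x'⟩ hx ⟨y, y'⟩ hy
    have := green_weyl hG K h2 hy hx
    simp only [hM, inner_add_left, inner_add_right, inner_smul_left, inner_smul_right,
      Complex.conj_I] at this
    rw [← hL, ← hR] at this
    simp only
    linear_combination this

end

end Helpers


variable {E F : Type*} [NormedAddCommGroup E] [InnerProductSpace ℂ E] [CompleteSpace E]
  [NormedAddCommGroup F] [InnerProductSpace ℂ F] [CompleteSpace F]

/-- the triangular transform of a B-generalized boundary pair by a densely
defined symmetric operator `E` is an AB-generalized boundary pair, and conversely every
AB-generalized boundary pair arises in this way. -/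
theorem statement6 (A : Set (E × E)) (Γ : Set ((E × E) × (F × F)))
    (hA : IsClosedSymRel A) (hB : IsBPair A Γ)
    (e : Set (F × F)) (he1 : IsLinRel e) (he2 : Dense (domR e)) (he3 : e ⊆ adjR e) :
    IsABPair A (triTransform Γ e) ∧
    -- Weyl function and γ-field of the transform
    (∀ l : ℂ, l.im ≠ 0 →
      weyl (triTransform Γ e) l =
        {p : F × F | ∃ h' w, (p.1, h') ∈ weyl Γ l ∧ (p.1, w) ∈ e ∧ p.2 = w + h'} ∧
      gfield (triTransform Γ e) l = {p ∈ gfield Γ l | p.1 ∈ domR e}) ∧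
    -- closedness
    (IsClosed (triTransform Γ e) ↔ IsClosed e) ∧
    (closure (triTransform Γ e) = triTransform Γ (closure e)) ∧
    -- converse
    (∀ Γ' : Set ((E × E) × (F × F)), IsABPair A Γ' →
      ∃ (Γ₀ : Set ((E × E) × (F × F))) (e₀ : Set (F × F)),
        IsBPair A Γ₀ ∧ IsLinRel e₀ ∧ Dense (domR e₀) ∧ e₀ ⊆ adjR e₀ ∧
        Γ' = triTransform Γ₀ e₀) := by
  have hclos : closure (triTransform Γ e) = triTransform Γ (closure e) ∧
      (IsClosed (triTransform Γ e) ↔ IsClosed e) := by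
    obtain ⟨K, M, hrep⟩ := B_rep hB
    have hA0 := hB.1.2.2.2
    have hcl : IsClosed (A0 Γ) := hA0 ▸ isClosed_adjR _
    have h0 : (0 : E × E) ∈ A0 Γ := hA0 ▸ (isLinRel_adjR _).zero_mem'
    have key : ∀ e' : Set (F × F), triTransform Γ e' = Phi K M '' (A0 Γ ×ˢ e') := by
      intro e'
      rw [← tri_Phi, ← hrep]
    rw [key, key]
    refine ⟨?_, ?_⟩
    · rw [← Homeomorph.image_closure, closure_prod_eq, hcl.closure_eq]
    · rw [Homeomorph.isClosed_image]
      refine ⟨fun h => ?_, fun h => hcl.prod h⟩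
      have : e = (fun x : F × F => ((0 : E × E), x)) ⁻¹' (A0 Γ ×ˢ e) := by
        ext x; simp [h0]
      rw [this]
      exact h.preimage (by fun_prop)
  refine ⟨AB_of_B hB he1 he2 he3, ?_, hclos.2, hclos.1, fun Γ' h => converse h⟩
  intro l _
  constructor
  · ext ⟨a, b⟩
    constructor
    · rintro ⟨f, h, h', w, hp, hw, heq⟩
      simp only [Prod.mk.injEq] at heq
      obtain ⟨rfl, rfl⟩ := heq
      exact ⟨h', w, ⟨f, hp⟩, hw, rfl⟩
    · rintro ⟨h', w, ⟨f, hp⟩, hw, heq⟩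
      simp only at heq
      subst heq
      exact ⟨f, a, h', w, hp, hw, rfl⟩
  · ext ⟨a, b⟩
    constructor
    · rintro ⟨q, h, h', w, hp, hw, heq⟩
      simp only [Prod.mk.injEq] at heq
      obtain ⟨rfl, rfl⟩ := heq
      exact ⟨⟨h', hp⟩, ⟨w, hw⟩⟩
    · rintro ⟨⟨h', hp⟩, ⟨w, hw⟩⟩
      exact ⟨w + h', a, h', w, hp, hw, rfl⟩

end BT
end
end
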